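/- Let u : ℝ³ → ℝ be a smooth solution of the universal hierarchy equation u_yy = u_t u_xy − u_y u_tx with u_y nowhere vanishing. Let φ : ℝ³ → ℝ be a smooth solution of the linearized UHE ℓ_E(φ) = 0, and suppose ψ : ℝ³ → ℝ is a smooth function satisfying the first-order system ∂_x ψ = u_y⁻¹ ( −∂_y φ + u_xy ψ ) and ∂_y ψ = ∂_t φ − u_y⁻¹ ( u_t ∂_y φ + (u_y u_tx − u_t u_xy) ψ ). Then ψ also satisfies ℓ_E(ψ) = 0. (The system defines a recursion operator R₊ for shadows of symmetries of the universal hierarchy equation.) -/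

import Mathlib

noncomputable section

/-- Partial derivative with respect to the first variable (`x`). -/
def Dx (f : ℝ → ℝ → ℝ → ℝ) (x y t : ℝ) : ℝ := deriv (fun x' => f x' y t) x

/-- Partial derivative with respect to the second variable (`y`). -/
def Dy (f : ℝ → ℝ → ℝ → ℝ) (x y t : ℝ) : ℝ := deriv (fun y' => f x y' t) y

/-- Partial derivative with respect to the third variable (`t`). -/
def Dt (f : ℝ → ℝ → ℝ → ℝ) (x y t : ℝ) : ℝ := deriv (fun t' => f x y t') t

/-- Smoothness of a function of three real variables `(x, y, t)`. -/
def Smooth3 (f : ℝ → ℝ → ℝ → ℝ) : Prop :=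
  ContDiff ℝ (⊤ : ℕ∞) (fun p : ℝ × ℝ × ℝ => f p.1 p.2.1 p.2.2)

/-- Linearization of the universal hierarchy equation `u_yy = u_t u_xy - u_y u_tx`
at a solution `u`. -/
def linUHE (u φ : ℝ → ℝ → ℝ → ℝ) (x y t : ℝ) : ℝ :=
  Dy (Dy φ) x y t - Dt u x y t * Dx (Dy φ) x y t + Dy u x y t * Dt (Dx φ) x y t
    - Dx (Dy u) x y t * Dt φ x y t + Dt (Dx u) x y t * Dy φ x y t

/-- The uncurried form of a function of three real variables. -/
def uncurry3 (f : ℝ → ℝ → ℝ → ℝ) (p : ℝ × ℝ × ℝ) : ℝ := f p.1 p.2.1 p.2.2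

theorem Smooth3.contDiff {f : ℝ → ℝ → ℝ → ℝ} (hf : Smooth3 f) :
    ContDiff ℝ (⊤ : ℕ∞) (uncurry3 f) := hf

theorem Smooth3.differentiable {f : ℝ → ℝ → ℝ → ℝ} (hf : Smooth3 f) :
    Differentiable ℝ (uncurry3 f) :=
  hf.contDiff.differentiable (by simp)

theorem Smooth3.hasDerivAt_x_fderiv {f : ℝ → ℝ → ℝ → ℝ} (hf : Smooth3 f) (x y t : ℝ) :
    HasDerivAt (fun s => f s y t) (fderiv ℝ (uncurry3 f) (x, y, t) (1, 0, 0)) x :=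
  HasFDerivAt.comp_hasDerivAt (f := fun s => (s, y, t)) x
    (hf.differentiable (x, y, t)).hasFDerivAt
    ((hasDerivAt_id x).prodMk ((hasDerivAt_const x y).prodMk (hasDerivAt_const x t)))

theorem Smooth3.Dx_eq_fderiv {f : ℝ → ℝ → ℝ → ℝ} (hf : Smooth3 f) (x y t : ℝ) :
    Dx f x y t = fderiv ℝ (uncurry3 f) (x, y, t) (1, 0, 0) :=
  (hf.hasDerivAt_x_fderiv x y t).deriv

theorem Smooth3.uncurry3_Dx {f : ℝ → ℝ → ℝ → ℝ} (hf : Smooth3 f) :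
    uncurry3 (Dx f) = fun p => fderiv ℝ (uncurry3 f) p (1, 0, 0) :=
  funext fun p => hf.Dx_eq_fderiv p.1 p.2.1 p.2.2

theorem Smooth3.dx {f : ℝ → ℝ → ℝ → ℝ} (hf : Smooth3 f) : Smooth3 (Dx f) := by
  change ContDiff ℝ (⊤ : ℕ∞) (uncurry3 (Dx f))
  rw [hf.uncurry3_Dx]
  exact (hf.contDiff.fderiv_right (by simp)).clm_apply contDiff_const

theorem Smooth3.hasDerivAt_y_fderiv {f : ℝ → ℝ → ℝ → ℝ} (hf : Smooth3 f) (x y t : ℝ) :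
    HasDerivAt (fun s => f x s t) (fderiv ℝ (uncurry3 f) (x, y, t) (0, 1, 0)) y :=
  HasFDerivAt.comp_hasDerivAt (f := fun s => (x, s, t)) y
    (hf.differentiable (x, y, t)).hasFDerivAt
    ((hasDerivAt_const y x).prodMk ((hasDerivAt_id y).prodMk (hasDerivAt_const y t)))

theorem Smooth3.Dy_eq_fderiv {f : ℝ → ℝ → ℝ → ℝ} (hf : Smooth3 f) (x y t : ℝ) :
    Dy f x y t = fderiv ℝ (uncurry3 f) (x, y, t) (0, 1, 0) :=
  (hf.hasDerivAt_y_fderiv x y t).deriv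

theorem Smooth3.hasDerivAt_y {f : ℝ → ℝ → ℝ → ℝ} (hf : Smooth3 f) (x y t : ℝ) :
    HasDerivAt (fun s => f x s t) (Dy f x y t) y :=
  (hf.hasDerivAt_y_fderiv x y t).differentiableAt.hasDerivAt

theorem Smooth3.uncurry3_Dy {f : ℝ → ℝ → ℝ → ℝ} (hf : Smooth3 f) :
    uncurry3 (Dy f) = fun p => fderiv ℝ (uncurry3 f) p (0, 1, 0) :=
  funext fun p => hf.Dy_eq_fderiv p.1 p.2.1 p.2.2

theorem Smooth3.dy {f : ℝ → ℝ → ℝ → ℝ} (hf : Smooth3 f) : Smooth3 (Dy f) := by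
  change ContDiff ℝ (⊤ : ℕ∞) (uncurry3 (Dy f))
  rw [hf.uncurry3_Dy]
  exact (hf.contDiff.fderiv_right (by simp)).clm_apply contDiff_const

theorem Smooth3.hasDerivAt_t_fderiv {f : ℝ → ℝ → ℝ → ℝ} (hf : Smooth3 f) (x y t : ℝ) :
    HasDerivAt (fun s => f x y s) (fderiv ℝ (uncurry3 f) (x, y, t) (0, 0, 1)) t :=
  HasFDerivAt.comp_hasDerivAt (f := fun s => (x, y, s)) t
    (hf.differentiable (x, y, t)).hasFDerivAt
    ((hasDerivAt_const t x).prodMk ((hasDerivAt_const t y).prodMk (hasDerivAt_id t)))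

theorem Smooth3.Dt_eq_fderiv {f : ℝ → ℝ → ℝ → ℝ} (hf : Smooth3 f) (x y t : ℝ) :
    Dt f x y t = fderiv ℝ (uncurry3 f) (x, y, t) (0, 0, 1) :=
  (hf.hasDerivAt_t_fderiv x y t).deriv

theorem Smooth3.hasDerivAt_t {f : ℝ → ℝ → ℝ → ℝ} (hf : Smooth3 f) (x y t : ℝ) :
    HasDerivAt (fun s => f x y s) (Dt f x y t) t :=
  (hf.hasDerivAt_t_fderiv x y t).differentiableAt.hasDerivAt

theorem Smooth3.uncurry3_Dt {f : ℝ → ℝ → ℝ → ℝ} (hf : Smooth3 f) :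
    uncurry3 (Dt f) = fun p => fderiv ℝ (uncurry3 f) p (0, 0, 1) :=
  funext fun p => hf.Dt_eq_fderiv p.1 p.2.1 p.2.2

theorem Smooth3.dt {f : ℝ → ℝ → ℝ → ℝ} (hf : Smooth3 f) : Smooth3 (Dt f) := by
  change ContDiff ℝ (⊤ : ℕ∞) (uncurry3 (Dt f))
  rw [hf.uncurry3_Dt]
  exact (hf.contDiff.fderiv_right (by simp)).clm_apply contDiff_const

theorem Smooth3.fderiv_fderiv_apply_comm {f : ℝ → ℝ → ℝ → ℝ} (hf : Smooth3 f)
    (p v w : ℝ × ℝ × ℝ) :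
    fderiv ℝ (fun q => fderiv ℝ (uncurry3 f) q v) p w =
      fderiv ℝ (fun q => fderiv ℝ (uncurry3 f) q w) p v := by
  have hd : DifferentiableAt ℝ (fderiv ℝ (uncurry3 f)) p :=
    ((hf.contDiff.fderiv_right (m := 1) (by norm_cast)).differentiable (by simp)) p
  have hs : IsSymmSndFDerivAt ℝ (uncurry3 f) p :=
    hf.contDiff.contDiffAt.isSymmSndFDerivAt (by simp; norm_cast)
  rw [fderiv_clm_apply hd (differentiableAt_const v),
    fderiv_clm_apply hd (differentiableAt_const w)]
  simpa using hs.eq w v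

theorem Smooth3.Dy_Dx_comm {f : ℝ → ℝ → ℝ → ℝ} (hf : Smooth3 f) :
    Dy (Dx f) = Dx (Dy f) := by
  ext x y t
  rw [hf.dx.Dy_eq_fderiv, hf.dy.Dx_eq_fderiv, hf.uncurry3_Dx, hf.uncurry3_Dy]
  exact hf.fderiv_fderiv_apply_comm _ _ _

theorem Smooth3.Dy_Dt_comm {f : ℝ → ℝ → ℝ → ℝ} (hf : Smooth3 f) :
    Dy (Dt f) = Dt (Dy f) := by
  ext x y t
  rw [hf.dt.Dy_eq_fderiv, hf.dy.Dt_eq_fderiv, hf.uncurry3_Dt, hf.uncurry3_Dy]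
  exact hf.fderiv_fderiv_apply_comm _ _ _

/-- The direct recursion operator `R₊` of the universal hierarchy equation maps shadows
to shadows. -/
theorem uhe_recursion_plus
    (u : ℝ → ℝ → ℝ → ℝ) (hu : Smooth3 u)
    (husol : ∀ x y t : ℝ, Dy (Dy u) x y t = Dt u x y t * Dx (Dy u) x y t - Dy u x y t * Dt (Dx u) x y t)
    (huy : ∀ x y t : ℝ, Dy u x y t ≠ 0)
    (φ : ℝ → ℝ → ℝ → ℝ) (hφ : Smooth3 φ)
    (hφsh : ∀ x y t : ℝ, linUHE u φ x y t = 0)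
    (ψ : ℝ → ℝ → ℝ → ℝ) (hψ : Smooth3 ψ)
    (hsys_x : ∀ x y t : ℝ,
      Dx ψ x y t = (Dy u x y t)⁻¹ * (-Dy φ x y t + Dx (Dy u) x y t * ψ x y t))
    (hsys_y : ∀ x y t : ℝ,
      Dy ψ x y t = Dt φ x y t - (Dy u x y t)⁻¹ *
        (Dt u x y t * Dy φ x y t
          + (Dy u x y t * Dt (Dx u) x y t - Dt u x y t * Dx (Dy u) x y t) * ψ x y t)) :
    ∀ x y t : ℝ, linUHE u ψ x y t = 0 := by
  have hDyφ : Dy φ = fun x y t => Dx (Dy u) x y t * ψ x y t - Dy u x y t * Dx ψ x y t := by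
    ext x y t
    rw [hsys_x]
    field_simp [huy x y t]
    ring
  have hDtφ : Dt φ = fun x y t =>
      Dy ψ x y t - Dt u x y t * Dx ψ x y t + Dt (Dx u) x y t * ψ x y t := by
    ext x y t
    rw [hsys_x, hsys_y]
    field_simp [huy x y t]
    ring
  intro x y t
  have hty : Dt (Dy φ) x y t =
      (Dt (Dx (Dy u)) x y t * ψ x y t + Dx (Dy u) x y t * Dt ψ x y t) -
        (Dt (Dy u) x y t * Dx ψ x y t + Dy u x y t * Dt (Dx ψ) x y t) := by
    rw [hDyφ]
    exact (((hu.dy.dx.hasDerivAt_t x y t).mul (hψ.hasDerivAt_t x y t)).sub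
      ((hu.dy.hasDerivAt_t x y t).mul (hψ.dx.hasDerivAt_t x y t))).deriv
  have hyt : Dy (Dt φ) x y t =
      Dy (Dy ψ) x y t - (Dy (Dt u) x y t * Dx ψ x y t + Dt u x y t * Dy (Dx ψ) x y t) +
        (Dy (Dt (Dx u)) x y t * ψ x y t + Dt (Dx u) x y t * Dy ψ x y t) := by
    rw [hDtφ]
    exact (((hψ.dy.hasDerivAt_y x y t).sub
      ((hu.dt.hasDerivAt_y x y t).mul (hψ.dx.hasDerivAt_y x y t))).add
      ((hu.dx.dt.hasDerivAt_y x y t).mul (hψ.hasDerivAt_y x y t))).deriv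
  rw [hφ.Dy_Dt_comm, hty, hu.Dy_Dt_comm, hψ.Dy_Dx_comm, hu.dx.Dy_Dt_comm, hu.Dy_Dx_comm] at hyt
  rw [linUHE]
  linear_combination -hyt
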